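/- Let k be a field of characteristic 2 and V a finite dimensional k-vector space. The complex 0 → Λ²(V^{(1)}) →^{∂₁} S²(V) ⊗ V^{(1)} →^{∂₀} S⁴(V) →^{f} Λ⁴(V) → 0, where ∂₁(x ∧ y) = x² ⊗ y − y² ⊗ x, ∂₀(xy ⊗ z) = xyz², and f is the canonical projection of the symmetric power onto the exterior power, is exact. -/

import Mathlib

open scoped TensorProduct

variable (k : Type*) [Field k] (σ : Type*) [Fintype σ]

/-- homogeneous polynomials of degree `d`: the model for `S^d(V)`, where
`V := S¹(V)` is the space of linear forms. -/
noncomputable abbrev SP (d : ℕ) : Submodule k (MvPolynomial σ k) :=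
  MvPolynomial.homogeneousSubmodule σ k d

/-- The Frobenius twist `V^{(1)} ⊆ S²(V)`: the `k`-span of the squares of linear forms. -/
noncomputable def VFrob : Submodule k (MvPolynomial σ k) :=
  Submodule.span k {q | ∃ x : SP k σ 1, q = (x : MvPolynomial σ k) ^ 2}

/-- the square `x²` of a linear form, as an element of `V^{(1)}` -/
noncomputable def sqF (x : SP k σ 1) : VFrob k σ :=
  ⟨(x : MvPolynomial σ k) ^ 2, Submodule.subset_span ⟨x, rfl⟩⟩


namespace TruncRes

open MvPolynomial

set_option linter.unusedSectionVars false

variable {k σ}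

lemma prod_X_mem {n : ℕ} (v : Fin n → σ) :
    (∏ i, X (v i) : MvPolynomial σ k) ∈ SP k σ n := by
  rw [mem_homogeneousSubmodule]
  simpa using IsHomogeneous.prod Finset.univ (fun i => (X (v i) : MvPolynomial σ k))
    (fun _ => 1) (fun i _ => isHomogeneous_X k (v i))

lemma SP_eq_span (n : ℕ) :
    SP k σ n = Submodule.span k (Set.range fun v : Fin n → σ => ∏ i, X (v i)) := by
  apply le_antisymm
  · rw [SP, ← homogeneousSubmodule_one_pow, homogeneousSubmodule_one_eq_span_X,
      Submodule.span_pow]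
    apply Submodule.span_mono
    intro p hp
    rw [Set.mem_pow] at hp
    obtain ⟨g, rfl⟩ := hp
    choose v hv using fun i => (g i).2
    refine ⟨v, ?_⟩
    simp only [hv, List.prod_ofFn]
  · rw [Submodule.span_le]
    rintro _ ⟨v, rfl⟩
    exact prod_X_mem v

lemma SP_ext {n : ℕ} {N : Type*} [AddCommMonoid N] [Module k N] (f g : SP k σ n →ₗ[k] N)
    (h : ∀ v : Fin n → σ, f ⟨∏ i, X (v i), prod_X_mem v⟩ = g ⟨∏ i, X (v i), prod_X_mem v⟩) :
    f = g := by
  have key : ∀ p (hp : p ∈ Submodule.span k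
      (Set.range fun v : Fin n → σ => (∏ i, X (v i) : MvPolynomial σ k))),
      ∀ hp' : p ∈ SP k σ n, f ⟨p, hp'⟩ = g ⟨p, hp'⟩ := by
    intro p hp
    induction hp using Submodule.span_induction with
    | mem x hx => obtain ⟨v, rfl⟩ := hx; intro _; exact h v
    | zero => intro hp'; exact (map_zero f).trans (map_zero g).symm
    | add x y hx hy ihx ihy =>
      intro _
      rw [← SP_eq_span] at hx hy
      have := congrArg₂ (· + ·) (ihx hx) (ihy hy)
      simp only [← map_add] at this
      exact this
    | smul a x hx ih =>
      intro _
      rw [← SP_eq_span] at hx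
      have := congrArg (a • ·) (ih hx)
      simp only [← map_smul] at this
      exact this
  ext ⟨p, hp⟩
  exact key p (by rw [← SP_eq_span]; exact hp) hp

/-- a variable as a linear form -/
noncomputable def xv (i : σ) : SP k σ 1 := ⟨X i, isHomogeneous_X k i⟩

/-- the square of a variable in the Frobenius twist -/
noncomputable def ev (i : σ) : VFrob k σ := sqF k σ (xv i)

lemma ev_coe (i : σ) : ((ev i : VFrob k σ) : MvPolynomial σ k) = X i ^ 2 := rfl

lemma ev_coe' (i : σ) :
    ((ev i : VFrob k σ) : MvPolynomial σ k) = monomial (Finsupp.single i 2) 1 := by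
  rw [ev_coe, X_pow_eq_monomial]

lemma VFrob_le [CharP k 2] :
    VFrob k σ ≤ Submodule.span k (Set.range fun i : σ => (X i ^ 2 : MvPolynomial σ k)) := by
  rw [VFrob, Submodule.span_le]
  rintro _ ⟨⟨x, hx⟩, rfl⟩
  have hx' := hx
  rw [SP, homogeneousSubmodule_one_eq_span_X] at hx'
  show x ^ 2 ∈ Submodule.span k (Set.range fun i : σ => (X i ^ 2 : MvPolynomial σ k))
  clear hx
  induction hx' using Submodule.span_induction with
  | mem x hx => obtain ⟨v, rfl⟩ := hx; exact Submodule.subset_span ⟨v, rfl⟩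
  | zero => simp
  | add x y hx hy ihx ihy => rw [CharTwo.add_sq]; exact add_mem ihx ihy
  | smul a x hx ih => rw [smul_pow]; exact Submodule.smul_mem _ _ ih

/-- the basis of squares of variables -/
noncomputable def eb [CharP k 2] : Module.Basis σ k (VFrob k σ) :=
  Module.Basis.mk (v := ev) (by
    apply LinearIndependent.of_comp (VFrob k σ).subtype
    have := (basisMonomials σ k).linearIndependent.comp (fun i : σ => Finsupp.single i 2)
      (fun i j h => by simpa [Finsupp.single_left_inj] using h)
    have h2 : (VFrob k σ).subtype ∘ ev =
        (basisMonomials σ k) ∘ (fun i : σ => Finsupp.single i 2) := by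
      ext1 i
      simp [ev_coe']
    rw [h2]
    exact this) (by
    rintro ⟨z, hz⟩ -
    have h := VFrob_le hz
    have h2 : Submodule.span k (Set.range fun i : σ => (X i ^ 2 : MvPolynomial σ k)) =
        (Submodule.span k (Set.range ev)).map (VFrob k σ).subtype := by
      rw [Submodule.map_span, ← Set.range_comp]
      rfl
    rw [h2] at h
    obtain ⟨w, hw, hwz⟩ := h
    have : w = ⟨z, hz⟩ := Subtype.ext hwz
    rwa [← this])

lemma eb_apply [CharP k 2] (i : σ) : (eb i : VFrob k σ) = ev i := by simp [eb]

lemma VFrob_le_SP : VFrob k σ ≤ SP k σ 2 := by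
  rw [VFrob, Submodule.span_le]
  rintro _ ⟨x, rfl⟩
  have := ((mem_homogeneousSubmodule _ _).mp x.2).pow 2
  rwa [one_mul] at this

/-- inclusion of the twist in `S²` -/
noncomputable def inc : VFrob k σ →ₗ[k] SP k σ 2 := Submodule.inclusion VFrob_le_SP

/-- the antisymmetrisation -/
noncomputable def d1alt : VFrob k σ [⋀^Fin 2]→ₗ[k] (SP k σ 2 ⊗[k] VFrob k σ) where
  toFun v := inc (v 0) ⊗ₜ[k] v 1 - inc (v 1) ⊗ₜ[k] v 0
  map_update_add' v i x y := by
    fin_cases i <;> simp [TensorProduct.add_tmul, TensorProduct.tmul_add] <;> abel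
  map_update_smul' v i a x := by
    fin_cases i <;> simp [TensorProduct.smul_tmul', smul_sub]
  map_eq_zero_of_eq' v i j h hij := by
    fin_cases i <;> fin_cases j <;> simp_all

/-- the differential `∂₁` -/
noncomputable def d1 : (⋀[k]^2 (VFrob k σ)) →ₗ[k] (SP k σ 2 ⊗[k] VFrob k σ) :=
  exteriorPower.alternatingMapLinearEquiv (R := k) (n := 2) (M := VFrob k σ)
    (N := SP k σ 2 ⊗[k] VFrob k σ) (d1alt (k := k) (σ := σ))

lemma d1_apply (v : Fin 2 → VFrob k σ) :
    d1 (exteriorPower.ιMulti k 2 v) = inc (v 0) ⊗ₜ[k] v 1 - inc (v 1) ⊗ₜ[k] v 0 := by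
  rw [d1, exteriorPower.alternatingMapLinearEquiv_apply_ιMulti]; rfl

/-- the differential `∂₀` -/
noncomputable def d0 : (SP k σ 2 ⊗[k] VFrob k σ) →ₗ[k] SP k σ 4 :=
  LinearMap.codRestrict _
    (TensorProduct.lift (((LinearMap.mul k (MvPolynomial σ k)).compl₂ (VFrob k σ).subtype).comp
      (SP k σ 2).subtype)) (by
    intro t
    induction t using TensorProduct.induction_on with
    | zero => rw [map_zero]; exact zero_mem _
    | add x y hx hy => rw [map_add]; exact add_mem hx hy
    | tmul q z => exact IsHomogeneous.mul q.2 (VFrob_le_SP z.2))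

lemma d0_apply (q : SP k σ 2) (z : VFrob k σ) :
    (d0 (q ⊗ₜ z) : MvPolynomial σ k) = q * z := rfl

lemma d0_d1 : (d0 (k := k) (σ := σ)) ∘ₗ d1 = 0 := by
  apply exteriorPower.linearMap_ext
  ext v
  simp [d1_apply, d0_apply, inc, mul_comm]

/-- projection to degree two -/
noncomputable def hc2 : MvPolynomial σ k →ₗ[k] SP k σ 2 :=
  LinearMap.codRestrict _ (homogeneousComponent 2) (fun p => homogeneousComponent_isHomogeneous 2 p)

lemma hc2_apply (p : MvPolynomial σ k) (hp : p ∈ SP k σ 2) : hc2 p = ⟨p, hp⟩ := by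
  ext1
  exact (homogeneousComponent_of_mem hp).trans (if_pos rfl)

section order

variable [LinearOrder σ]

open Classical in
/-- contracting homotopy on `S⁴` -/
noncomputable def hmap : MvPolynomial σ k →ₗ[k] (SP k σ 2 ⊗[k] VFrob k σ) :=
  (basisMonomials σ k).constr k (fun m =>
    if hm : ∃ i, 2 ≤ m i ∧ ∀ j, 2 ≤ m j → i ≤ j then
      hc2 (monomial (m - Finsupp.single hm.choose 2) 1) ⊗ₜ ev hm.choose else 0)

lemma hmap_apply (m : σ →₀ ℕ) (i : σ) (hi : ∀ j, 2 ≤ (m + Finsupp.single i 2 : σ →₀ ℕ) j → i ≤ j) :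
    hmap (monomial m 1 * monomial (Finsupp.single i 2) 1 : MvPolynomial σ k) =
      hc2 (monomial m 1) ⊗ₜ ev i := by
  have hm : ∃ i', 2 ≤ (m + Finsupp.single i 2 : σ →₀ ℕ) i' ∧
      ∀ j, 2 ≤ (m + Finsupp.single i 2 : σ →₀ ℕ) j → i' ≤ j := ⟨i, by simp, hi⟩
  have h1 : hm.choose = i :=
    le_antisymm (hm.choose_spec.2 i (by simp)) (hi _ hm.choose_spec.1)
  rw [monomial_mul, one_mul]
  have hb : (monomial (m + Finsupp.single i 2) 1 : MvPolynomial σ k) =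
      basisMonomials σ k (m + Finsupp.single i 2) := by simp
  rw [hb, hmap, Module.Basis.constr_basis, dif_pos hm, h1,
    add_tsub_cancel_right]

/-- contracting homotopy on `S² ⊗ V^{(1)}` -/
noncomputable def rho : (SP k σ 2 ⊗[k] VFrob k σ) →ₗ[k] (⋀[k]^2 (VFrob k σ)) :=
  TensorProduct.lift (∑ i : σ, ∑ j : σ, if i < j then
    LinearMap.mk₂ k (fun (q : SP k σ 2) (z : VFrob k σ) =>
      (coeff (Finsupp.single i 2) (q : MvPolynomial σ k) *
        coeff (Finsupp.single j 2) (z : MvPolynomial σ k)) •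
          exteriorPower.ιMulti k 2 ![ev i, ev j])
      (by intros; simp [add_mul, add_smul]) (by intros; simp [mul_smul])
      (by intros; simp [mul_add, add_smul])
      (by intros; simp only [Submodule.coe_smul, coeff_smul, smul_eq_mul, ← mul_smul]; ring_nf) else 0)

lemma rho_apply (q : SP k σ 2) (j : σ) : rho (q ⊗ₜ ev j) =
    ∑ i : σ, if i < j then coeff (Finsupp.single i 2) (q : MvPolynomial σ k) •
      exteriorPower.ιMulti k 2 ![ev i, ev j] else 0 := by
  rw [rho, TensorProduct.lift.tmul]
  simp only [LinearMap.sum_apply]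
  refine Finset.sum_congr rfl fun i _ => ?_
  rw [Finset.sum_eq_single j]
  · split_ifs
    · simp [ev_coe']
    · rfl
  · intro b _ hb
    split_ifs
    · simp [ev_coe', coeff_monomial, Finsupp.single_left_inj, hb.symm]
    · rfl
  · simp

lemma rho_ev (i j : σ) : rho (inc (ev i : VFrob k σ) ⊗ₜ ev j) =
    if i < j then exteriorPower.ιMulti k 2 ![ev i, ev j] else 0 := by
  rw [rho_apply, Finset.sum_eq_single i]
  · split_ifs <;> simp [inc, ev_coe']
  · intro b _ hb
    split_ifs
    · simp [inc, ev_coe', coeff_monomial, Finsupp.single_left_inj, hb.symm]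
    · rfl
  · simp

lemma rho_ne (a b j : σ) (hab : a ≠ b) (h) :
    rho ((⟨X a * X b, h⟩ : SP k σ 2) ⊗ₜ ev j) = 0 := by
  rw [rho_apply]
  refine Finset.sum_eq_zero fun i _ => ?_
  split_ifs
  · have : Finsupp.single i 2 ≠ (Finsupp.single a 1 + Finsupp.single b 1 : σ →₀ ℕ) := by
      intro h
      have h1 := DFunLike.congr_fun h a
      have h2 := DFunLike.congr_fun h b
      simp [Finsupp.single_apply, hab, hab.symm] at h1 h2
      grind
    simp [X, monomial_mul, coeff_monomial, this.symm]
  · rfl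

lemma rho_d1 [CharP k 2] : (rho (k := k) (σ := σ)) ∘ₗ d1 = LinearMap.id := by
  apply exteriorPower.linearMap_ext
  apply eb.ext_alternating
  intro v hv
  have hne : v 0 ≠ v 1 := fun h => by simpa using hv h
  simp only [LinearMap.compAlternatingMap_apply, LinearMap.comp_apply, d1_apply, eb_apply,
    map_sub, rho_ev, LinearMap.id_apply]
  have e1 : (fun i => (ev (v i) : VFrob k σ)) = ![ev (v 0), ev (v 1)] := by
    ext1 i; fin_cases i <;> rfl
  rw [e1]
  rcases lt_or_gt_of_ne hne with h | h
  · simp [h, not_lt_of_gt h]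
  · rw [if_neg (not_lt_of_gt h), if_pos h, zero_sub]
    have := (exteriorPower.ιMulti k 2).map_swap (![ev (v 0), ev (v 1)] : Fin 2 → VFrob k σ)
      (i := 0) (j := 1) (by simp)
    rw [← neg_eq_iff_eq_neg] at this
    rw [← this]
    congr 2
    ext1 i; fin_cases i <;> rfl

lemma homotopy_X [CharP k 2] (a b j : σ) (hmem : (X a * X b : MvPolynomial σ k) ∈ SP k σ 2) :
    hmap (X a * X b * X j ^ 2 : MvPolynomial σ k) +
      d1 (rho ((⟨X a * X b, hmem⟩ : SP k σ 2) ⊗ₜ[k] ev j)) =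
      (⟨X a * X b, hmem⟩ : SP k σ 2) ⊗ₜ[k] ev j := by
  have hinc' (a : σ) : hc2 (monomial (Finsupp.single a 2) 1 : MvPolynomial σ k) = inc (ev a) := by
    rw [hc2_apply _ (ev_coe' (k := k) a ▸ VFrob_le_SP (ev a).2)]
    ext1
    simp [inc, ev_coe']
  by_cases hab : a = b
  · subst hab
    have hinc : (⟨X a * X a, hmem⟩ : SP k σ 2) = inc (ev a) := by
      ext1; simp [inc, ev_coe, sq]
    have hsq : (X a * X a : MvPolynomial σ k) = monomial (Finsupp.single a 2) 1 := by
      rw [← sq, X_pow_eq_monomial]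
    rw [X_pow_eq_monomial, hinc, hsq, rho_ev]
    split_ifs with h
    · rw [mul_comm, hmap_apply, hinc', d1_apply]
      · simp
      · intro i hi
        simp [Finsupp.single_apply] at hi
        grind
    · rw [hmap_apply, hinc']
      · simp
      · intro i hi
        simp [Finsupp.single_apply] at hi
        grind
  · have hX : (X a * X b : MvPolynomial σ k) =
      monomial (Finsupp.single a 1 + Finsupp.single b 1) 1 := by simp [X, monomial_mul]
    rw [rho_ne a b j hab, map_zero, add_zero, X_pow_eq_monomial]
    have := hmap_apply (k := k) (Finsupp.single a 1 + Finsupp.single b 1) j (by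
      intro i hi
      simp [Finsupp.single_apply] at hi
      grind)
    rwa [← hX, hc2_apply _ hmem] at this

lemma homotopy [CharP k 2] (t : SP k σ 2 ⊗[k] VFrob k σ) :
    hmap (d0 t : MvPolynomial σ k) + d1 (rho t) = t := by
  have : hmap ∘ₗ (SP k σ 4).subtype ∘ₗ d0 + d1 ∘ₗ rho =
      (LinearMap.id : (SP k σ 2 ⊗[k] VFrob k σ) →ₗ[k] _) := by
    apply TensorProduct.ext
    apply SP_ext
    intro v
    apply eb.ext
    intro j
    simp only [Fin.prod_univ_two, eb_apply]
    exact homotopy_X (v 0) (v 1) j _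
  exact DFunLike.congr_fun this t

end order


section fmap

lemma ext_mul_comm [CharP k 2] {M : Type*} [AddCommGroup M] [Module k M]
    (a b : ExteriorAlgebra k M) : a * b = b * a := by
  have h2 : ∀ c : ExteriorAlgebra k M, c + c = 0 := fun c => by
    rw [← two_smul k c, CharTwo.two_eq_zero, zero_smul]
  induction a using ExteriorAlgebra.induction with
  | algebraMap r => exact Algebra.commutes r b
  | add x y hx hy => rw [add_mul, mul_add, hx, hy]
  | mul x y hx hy => rw [mul_assoc, hy, ← mul_assoc, hx, mul_assoc]
  | ι x =>
    induction b using ExteriorAlgebra.induction with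
    | algebraMap r => exact (Algebra.commutes r _).symm
    | add x y hx hy => rw [add_mul, mul_add, hx, hy]
    | mul x y hx hy => rw [← mul_assoc, hx, mul_assoc, hy, mul_assoc]
    | ι y =>
      have h := ExteriorAlgebra.ι_add_mul_swap (R := k) x y
      rw [eq_neg_of_add_eq_zero_left h]
      exact (eq_neg_of_add_eq_zero_left (h2 _)).symm

/-- in characteristic two the exterior algebra is commutative -/
noncomputable abbrev extComm [CharP k 2] (M : Type*) [AddCommGroup M] [Module k M] :
    CommRing (ExteriorAlgebra k M) :=
  { (inferInstance : Ring (ExteriorAlgebra k M)) with mul_comm := ext_mul_comm }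

lemma exists_F [CharP k 2] : ∃ F : MvPolynomial σ k →ₐ[k] ExteriorAlgebra k (SP k σ 1),
    ∀ x : SP k σ 1, F x = ExteriorAlgebra.ι k x := by
  letI := extComm (k := k) (SP k σ 1)
  let F : MvPolynomial σ k →ₐ[k] ExteriorAlgebra k (SP k σ 1) :=
    aeval (fun i => ExteriorAlgebra.ι k (xv i))
  refine ⟨F, fun x => ?_⟩
  have : F.toLinearMap ∘ₗ (SP k σ 1).subtype = ExteriorAlgebra.ι k := by
    apply SP_ext
    intro v
    simp only [Fin.prod_univ_one]
    exact aeval_X _ _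
  exact DFunLike.congr_fun this x

lemma F_ι {F : MvPolynomial σ k →ₐ[k] ExteriorAlgebra k (SP k σ 1)}
    (hF : ∀ x : SP k σ 1, F x = ExteriorAlgebra.ι k x) (x : Fin 4 → SP k σ 1) :
    F (∏ i, (x i : MvPolynomial σ k)) = ExteriorAlgebra.ιMulti k 4 x := by
  rw [ExteriorAlgebra.ιMulti_apply, ← List.prod_ofFn, map_list_prod, List.map_ofFn]
  congr 2
  ext1 i
  exact hF _

lemma F_mem {F : MvPolynomial σ k →ₐ[k] ExteriorAlgebra k (SP k σ 1)}
    (hF : ∀ x : SP k σ 1, F x = ExteriorAlgebra.ι k x) (s : SP k σ 4) :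
    F s ∈ ⋀[k]^4 (SP k σ 1) := by
  have hs := (SP_eq_span (k := k) (σ := σ) 4).le s.2
  have : Submodule.span k (Set.range fun v : Fin 4 → σ => (∏ i, X (v i) : MvPolynomial σ k)) ≤
      (⋀[k]^4 (SP k σ 1)).comap F.toLinearMap := by
    rw [Submodule.span_le]
    rintro _ ⟨v, rfl⟩
    have := F_ι hF (fun i => xv (v i))
    show F (∏ i, X (v i)) ∈ ⋀[k]^4 (SP k σ 1)
    rw [show (∏ i, X (v i) : MvPolynomial σ k) =
      ∏ i, ((xv (v i) : SP k σ 1) : MvPolynomial σ k) from rfl, this]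
    exact (exteriorPower.ιMulti k 4 (fun i => xv (v i))).2
  exact this hs

lemma F_VFrob {F : MvPolynomial σ k →ₐ[k] ExteriorAlgebra k (SP k σ 1)}
    (hF : ∀ x : SP k σ 1, F x = ExteriorAlgebra.ι k x) (z : VFrob k σ) : F z = 0 := by
  have : VFrob k σ ≤ LinearMap.ker F.toLinearMap := by
    rw [VFrob, Submodule.span_le]
    rintro _ ⟨x, rfl⟩
    show F _ = 0
    rw [map_pow, hF, sq, ExteriorAlgebra.ι_sq_zero]
  exact this z.2

lemma prod_mem (x : Fin 4 → SP k σ 1) : (∏ i, (x i : MvPolynomial σ k)) ∈ SP k σ 4 := by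
  rw [mem_homogeneousSubmodule]
  simpa using IsHomogeneous.prod Finset.univ (fun i => (x i : MvPolynomial σ k))
    (fun _ => 1) (fun i _ => (x i).2)

/-- multiplication of four linear forms modulo the image of `∂₀` -/
noncomputable def galt : SP k σ 1 [⋀^Fin 4]→ₗ[k]
    (SP k σ 4 ⧸ LinearMap.range (d0 (k := k) (σ := σ))) :=
  { (Submodule.mkQ (LinearMap.range (d0 (k := k) (σ := σ)))).compMultilinearMap
      (((MultilinearMap.mkPiAlgebra k (Fin 4) (MvPolynomial σ k)).compLinearMap
        (fun _ => (SP k σ 1).subtype)).codRestrict (SP k σ 4) (fun x => prod_mem x)) with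
    map_eq_zero_of_eq' := by
      intro v i j h hij
      show Submodule.Quotient.mk (p := LinearMap.range (d0 (k := k) (σ := σ)))
        (⟨∏ i, (v i : MvPolynomial σ k), prod_mem v⟩ : SP k σ 4) = 0
      rw [Submodule.Quotient.mk_eq_zero]
      have hq : (∏ l ∈ (Finset.univ.erase i).erase j, (v l : MvPolynomial σ k)) ∈ SP k σ 2 := by
        rw [mem_homogeneousSubmodule]
        have := IsHomogeneous.prod ((Finset.univ.erase i).erase j)
          (fun i => (v i : MvPolynomial σ k)) (fun _ => 1) (fun i _ => (v i).2)
        rw [Finset.sum_const, Finset.card_erase_of_mem (by simp [hij.symm]),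
          Finset.card_erase_of_mem (by simp)] at this
        simpa using this
      refine ⟨(⟨_, hq⟩ : SP k σ 2) ⊗ₜ sqF k σ (v i), ?_⟩
      ext1
      rw [d0_apply]
      show _ * (v i : MvPolynomial σ k) ^ 2 = ∏ l, (v l : MvPolynomial σ k)
      rw [← Finset.mul_prod_erase _ _ (Finset.mem_univ i),
        ← Finset.mul_prod_erase _ _ (show j ∈ Finset.univ.erase i by simp [hij.symm]), ← h]
      ring }

lemma galt_apply (x : Fin 4 → SP k σ 1) : galt x =
    Submodule.mkQ (LinearMap.range (d0 (k := k) (σ := σ))) ⟨_, prod_mem x⟩ := rfl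

end fmap

end TruncRes

/-- Let `k` be a field of characteristic 2 and `V` a finite dimensional
`k`-vector space (modelled as the space of linear forms in `MvPolynomial σ k`, `σ` finite).
The complex `0 → Λ²(V^{(1)}) →^{∂₁} S²(V) ⊗ V^{(1)} →^{∂₀} S⁴(V) →^{f} Λ⁴(V) → 0`, with
`∂₁(x ∧ y) = x²⊗y − y²⊗x`, `∂₀(q ⊗ z) = q·z` (i.e. `xy ⊗ z² ↦ xyz²`), and `f` the canonical
projection sending `x₁x₂x₃x₄` to `x₁∧x₂∧x₃∧x₄`, is exact. -/
theorem truncated_symmetric_resolution_exact [CharP k 2] :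
    ∃ (d1 : (⋀[k]^2 (VFrob k σ)) →ₗ[k] ((SP k σ 2) ⊗[k] (VFrob k σ)))
      (d0 : ((SP k σ 2) ⊗[k] (VFrob k σ)) →ₗ[k] (SP k σ 4))
      (f : (SP k σ 4) →ₗ[k] (⋀[k]^4 (SP k σ 1))),
      (∀ (x y : SP k σ 1) (w : ⋀[k]^2 (VFrob k σ)),
          (w : ExteriorAlgebra k (VFrob k σ)) =
            ExteriorAlgebra.ιMulti k 2 ![sqF k σ x, sqF k σ y] →
          d1 w = (⟨(x : MvPolynomial σ k) ^ 2, by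
                    rw [MvPolynomial.mem_homogeneousSubmodule]
                    simpa only [one_mul] using
                      ((MvPolynomial.mem_homogeneousSubmodule _ _).mp x.2).pow 2⟩ :
                  SP k σ 2) ⊗ₜ[k] sqF k σ y -
                (⟨(y : MvPolynomial σ k) ^ 2, by
                    rw [MvPolynomial.mem_homogeneousSubmodule]
                    simpa only [one_mul] using
                      ((MvPolynomial.mem_homogeneousSubmodule _ _).mp y.2).pow 2⟩ :
                  SP k σ 2) ⊗ₜ[k] sqF k σ x) ∧
      (∀ (q : SP k σ 2) (z : VFrob k σ),
          ((d0 (q ⊗ₜ[k] z) : MvPolynomial σ k)) =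
            (q : MvPolynomial σ k) * (z : MvPolynomial σ k)) ∧
      (∀ (x₁ x₂ x₃ x₄ : SP k σ 1) (s : SP k σ 4) (w : ⋀[k]^4 (SP k σ 1)),
          (s : MvPolynomial σ k) =
            (x₁ : MvPolynomial σ k) * x₂ * x₃ * x₄ →
          (w : ExteriorAlgebra k (SP k σ 1)) =
            ExteriorAlgebra.ιMulti k 4 ![x₁, x₂, x₃, x₄] →
          f s = w) ∧
      Function.Injective d1 ∧
      (∀ t, d0 t = 0 ↔ t ∈ LinearMap.range d1) ∧
      (∀ s, f s = 0 ↔ s ∈ LinearMap.range d0) ∧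
      Function.Surjective f := by
  
  classical
  letI : LinearOrder σ := IsWellOrder.linearOrder WellOrderingRel
  obtain ⟨F, hF⟩ := TruncRes.exists_F (k := k) (σ := σ)
  let f : SP k σ 4 →ₗ[k] ⋀[k]^4 (SP k σ 1) :=
    LinearMap.codRestrict _ (F.toLinearMap ∘ₗ (SP k σ 4).subtype) (TruncRes.F_mem hF)
  have hf : ∀ x : Fin 4 → SP k σ 1,
      f ⟨_, TruncRes.prod_mem x⟩ = exteriorPower.ιMulti k 4 x := by
    intro x
    ext1
    exact TruncRes.F_ι hF x
  have hgf : (exteriorPower.alternatingMapLinearEquiv (TruncRes.galt (k := k) (σ := σ))) ∘ₗ f =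
      Submodule.mkQ _ := by
    apply TruncRes.SP_ext
    intro v
    have h := hf (fun i => TruncRes.xv (v i))
    have h2 := congrArg (exteriorPower.alternatingMapLinearEquiv
      (TruncRes.galt (k := k) (σ := σ))) h
    rw [exteriorPower.alternatingMapLinearEquiv_apply_ιMulti, TruncRes.galt_apply] at h2
    exact h2
  refine ⟨TruncRes.d1, TruncRes.d0, f, ?_, ?_, ?_, ?_, ?_, ?_, ?_⟩
  · intro x y w hw
    have : w = exteriorPower.ιMulti k 2 ![sqF k σ x, sqF k σ y] := Subtype.ext hw
    rw [this, TruncRes.d1_apply]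
    rfl
  · intro q z
    exact TruncRes.d0_apply q z
  · intro x₁ x₂ x₃ x₄ s w hs hw
    have h1 : w = exteriorPower.ιMulti k 4 ![x₁, x₂, x₃, x₄] := Subtype.ext hw
    rw [h1, ← hf]
    congr 1
    ext1
    rw [hs]
    simp [Fin.prod_univ_four]
  · exact Function.LeftInverse.injective (g := TruncRes.rho)
      (fun w => DFunLike.congr_fun TruncRes.rho_d1 w)
  · intro t
    constructor
    · intro ht
      have h := TruncRes.homotopy t
      rw [ht, ZeroMemClass.coe_zero, map_zero, zero_add] at h
      exact ⟨_, h⟩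
    · rintro ⟨w, rfl⟩
      exact DFunLike.congr_fun TruncRes.d0_d1 w
  · intro s
    constructor
    · intro hs
      have h := DFunLike.congr_fun hgf s
      rw [LinearMap.comp_apply, hs, map_zero] at h
      exact (Submodule.Quotient.mk_eq_zero _).mp h.symm
    · rintro ⟨t, rfl⟩
      induction t using TensorProduct.induction_on with
      | zero => simp
      | add x y hx hy => rw [map_add, map_add, hx, hy, add_zero]
      | tmul q z =>
        ext1
        show F (TruncRes.d0 (q ⊗ₜ[k] z) : MvPolynomial σ k) = 0
        rw [TruncRes.d0_apply, map_mul, TruncRes.F_VFrob hF, mul_zero]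
  · rw [← LinearMap.range_eq_top, eq_top_iff, ← exteriorPower.ιMulti_span, Submodule.span_le]
    rintro _ ⟨x, rfl⟩
    exact ⟨_, hf x⟩
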